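/- Let Γ be a labelled graph with vertex set V, let T ⊆ V be the set of cone points of Γ, and suppose the special subgroup A_T of the Artin group A_Γ has trivial center when regarded as the Artin group of the induced subgraph Γ_T. Then A_Γ has trivial center. -/

import Mathlib

/-- A labelled graph: a vertex set `V` and a symmetric labelling `m : V → V → ℕ∞`
with `m u v ≥ 2` for `u ≠ v` (`m u v = ∞` means no edge). -/
structure LabelledGraph (V : Type*) where
  m : V → V → ℕ∞
  symm : ∀ u v, m u v = m v u
  two_le : ∀ u v, u ≠ v → 2 ≤ m u v

namespace LabelledGraph

variable {V W : Type*}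

/-- The alternating product `x * y * x * ⋯` with `n` terms. -/
def altProd {G : Type*} [Monoid G] (x y : G) : ℕ → G
  | 0 => 1
  | n + 1 => x * altProd y x n

/-- The alternating word `u v u v ⋯` with `n` terms in the free group. -/
def altWord (u v : V) (n : ℕ) : FreeGroup V :=
  altProd (FreeGroup.of u) (FreeGroup.of v) n

/-- The Artin relations of a labelled graph: for each `u ≠ v` with finite label
`m u v = k`, the relation `(u v u ⋯) = (v u v ⋯)` (both sides with `k` terms). -/
def artinRels (Γ : LabelledGraph V) : Set (FreeGroup V) :=
  { r | ∃ (u v : V) (k : ℕ), u ≠ v ∧ Γ.m u v = (k : ℕ∞) ∧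
        r = altWord u v k * (altWord v u k)⁻¹ }

/-- The Artin group of a labelled graph. -/
abbrev ArtinGroup (Γ : LabelledGraph V) : Type _ := PresentedGroup Γ.artinRels

/-- The standard generators of an Artin group. -/
def σ (Γ : LabelledGraph V) (v : V) : Γ.ArtinGroup := PresentedGroup.of v

/-- The special subgroup of the Artin group generated by `{σ v : v ∈ K}`. -/
def specialSubgroup (Γ : LabelledGraph V) (K : Set V) : Subgroup Γ.ArtinGroup :=
  Subgroup.closure (Γ.σ '' K)

/-- A cone point of `Γ`: a vertex `t` with `m t v < ∞` for every `v ≠ t`. -/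
def IsConePoint (Γ : LabelledGraph V) (t : V) : Prop :=
  ∀ v : V, v ≠ t → Γ.m t v ≠ ⊤

/-- The induced labelled subgraph on a subset `K` of the vertices. -/
def induce (Γ : LabelledGraph V) (K : Set V) : LabelledGraph K where
  m u v := Γ.m u v
  symm u v := Γ.symm u v
  two_le u v h := Γ.two_le u v (fun e => h (Subtype.ext e))

/-- `Γ` is irreducible if its vertex set admits no partition into two nonempty sets
with all labels between the two parts equal to `2`. -/
def Irreducible (Γ : LabelledGraph V) : Prop :=
  ¬ ∃ V₁ V₂ : Set V, V₁.Nonempty ∧ V₂.Nonempty ∧ Disjoint V₁ V₂ ∧ V₁ ∪ V₂ = Set.univ ∧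
      ∀ u ∈ V₁, ∀ v ∈ V₂, Γ.m u v = 2

/-- The square relations `σ_v² = 1` defining the Coxeter quotient. -/
def squareRels (V : Type*) : Set (FreeGroup V) :=
  Set.range fun v : V => FreeGroup.of v * FreeGroup.of v

/-- The Coxeter group of a labelled graph: the quotient of the Artin group obtained
by adding the relations `σ_v² = 1`. -/
abbrev CoxeterGroupOf (Γ : LabelledGraph V) : Type _ :=
  PresentedGroup (Γ.artinRels ∪ squareRels V)

/-- `Γ` is spherical if its Coxeter group is finite. -/
def Spherical (Γ : LabelledGraph V) : Prop := Finite Γ.CoxeterGroupOf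

/-- The natural surjection `θ` from the Artin group to the Coxeter group. -/
def artinToCoxeter (Γ : LabelledGraph V) : Γ.ArtinGroup →* Γ.CoxeterGroupOf :=
  QuotientGroup.map _ _ (MonoidHom.id _)
    (by
      intro x hx
      simpa using Subgroup.normalClosure_mono (Set.subset_union_left (t := squareRels V)) hx)

/-- The pure Artin group: the kernel of the natural surjection to the Coxeter group. -/
def pureArtinGroup (Γ : LabelledGraph V) : Subgroup Γ.ArtinGroup :=
  (artinToCoxeter Γ).ker

/-- `P : Fin n → Set V` is a decomposition of `Γ` as a `2`-labelled join of
irreducible induced subgraphs. -/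
def IsIrredDecomp (Γ : LabelledGraph V) (n : ℕ) (P : Fin n → Set V) : Prop :=
  (∀ i, (P i).Nonempty) ∧
  (⋃ i, P i) = Set.univ ∧
  (∀ i j, i ≠ j → Disjoint (P i) (P j)) ∧
  (∀ i j, i ≠ j → ∀ u ∈ P i, ∀ v ∈ P j, Γ.m u v = 2) ∧
  (∀ i, (Γ.induce (P i)).Irreducible)

/-- `Γ` satisfies the Center Conjecture if for the (finest) decomposition of `Γ` as a
`2`-labelled join of irreducible induced subgraphs `Γ₁, …, Γₙ`, the center of the Artin
group `A_Γ` is free abelian of rank the number of spherical factors `Γᵢ`. -/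
def SatisfiesCenterConjecture (Γ : LabelledGraph V) : Prop :=
  ∀ (n : ℕ) (P : Fin n → Set V), Γ.IsIrredDecomp n P →
    Nonempty ((Subgroup.center Γ.ArtinGroup) ≃*
      Multiplicative (Fin (Nat.card {i : Fin n // (Γ.induce (P i)).Spherical}) → ℤ))

/-- A monoid hom applied to an alternating product. -/
theorem map_altProd {G H : Type*} [Monoid G] [Monoid H] (φ : G →* H) (x y : G) (n : ℕ) :
    φ (altProd x y n) = altProd (φ x) (φ y) n := by
  induction n generalizing x y with
  | zero => simp [altProd]
  | succ n ih => simp [altProd, ih]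

/-- The homomorphism between Artin groups induced by a label-preserving injection of
labelled graphs, sending generators to generators. -/
def mapHom (Γ : LabelledGraph V) (Δ : LabelledGraph W) (f : V → W)
    (hf : ∀ u v : V, u ≠ v → f u ≠ f v)
    (hm : ∀ u v : V, Γ.m u v = Δ.m (f u) (f v)) :
    Γ.ArtinGroup →* Δ.ArtinGroup :=
  PresentedGroup.toGroup (f := fun v => Δ.σ (f v))
    (by
      rintro r ⟨u, v, k, huv, hk, rfl⟩
      have key : ∀ (a b : V),
          FreeGroup.lift (fun v => Δ.σ (f v)) (altWord a b k)
            = PresentedGroup.mk Δ.artinRels (altWord (f a) (f b) k) := by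
        intro a b
        rw [altWord, map_altProd, altWord, map_altProd]
        simp [σ, PresentedGroup.of]
      rw [map_mul, map_inv, key, key, ← map_inv, ← map_mul]
      refine (QuotientGroup.eq_one_iff _).mpr (Subgroup.subset_normalClosure ?_)
      exact ⟨f u, f v, k, hf u v huv, (hm u v) ▸ hk, rfl⟩)

@[simp]
theorem mapHom_σ (Γ : LabelledGraph V) (Δ : LabelledGraph W) (f : V → W)
    (hf : ∀ u v : V, u ≠ v → f u ≠ f v)
    (hm : ∀ u v : V, Γ.m u v = Δ.m (f u) (f v)) (v : V) :
    mapHom Γ Δ f hf hm (Γ.σ v) = Δ.σ (f v) :=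
  PresentedGroup.toGroup.of _

/-- The homomorphism between the Artin groups of induced subgraphs coming from an
inclusion `K' ⊆ K`. -/
def induceHom (Γ : LabelledGraph V) {K' K : Set V} (h : K' ⊆ K) :
    (Γ.induce K').ArtinGroup →* (Γ.induce K).ArtinGroup :=
  mapHom _ _ (Set.inclusion h)
    (fun _ _ huv e => huv (Set.inclusion_injective h e))
    (fun _ _ => rfl)

/-- The homomorphism from the Artin group of an induced subgraph to the ambient
Artin group. -/
def inclHom (Γ : LabelledGraph V) (K : Set V) :
    (Γ.induce K).ArtinGroup →* Γ.ArtinGroup :=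
  mapHom _ _ Subtype.val
    (fun _ _ huv e => huv (Subtype.ext e))
    (fun _ _ => rfl)

end LabelledGraph

/-! ### The center of an amalgamated product -/

namespace Monoid.PushoutI

variable {ι : Type*} {G : ι → Type*} {H : Type*} [∀ i, Group (G i)] [Group H]
  {φ : ∀ i, H →* G i}

/-- A list of letters, none in the base group, with consecutive letters in distinct factors. -/
structure IsReducedList (φ : ∀ i, H →* G i) (l : List (Σ i, G i)) : Prop where
  isChain : l.IsChain fun g g' => g.1 ≠ g'.1
  notMem : ∀ g ∈ l, g.2 ∉ (φ g.1).range

/-- The product of a list of letters. -/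
def listProd (φ : ∀ i, H →* G i) (l : List (Σ i, G i)) : PushoutI φ :=
  (l.map fun g => of g.1 g.2).prod

theorem IsReducedList.exists_normalWord (d : NormalWord.Transversal φ) {l : List (Σ i, G i)}
    (hl : IsReducedList φ l) (h : H) :
    ∃ w : NormalWord d, w.prod = base φ h * listProd φ l ∧
      w.toList.map Sigma.fst = l.map Sigma.fst := by
  let w₀ : CoprodI.Word G := ⟨l, fun g hg h₁ => hl.notMem g hg (h₁ ▸ one_mem _), hl.isChain⟩
  obtain ⟨w, hw, hw'⟩ := Reduced.exists_normalWord_prod_eq d (w := w₀) hl.notMem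
  refine ⟨h • w, ?_, hw'⟩
  rw [NormalWord.prod_base_smul, hw, CoprodI.Word.prod, map_list_prod, List.map_map, listProd]
  simp [w₀, Function.comp_def]

theorem IsReducedList.map_fst_eq (hφ : ∀ i, Function.Injective (φ i)) {l l' : List (Σ i, G i)}
    (hl : IsReducedList φ l) (hl' : IsReducedList φ l') {h h' : H}
    (e : base φ h * listProd φ l = base φ h' * listProd φ l') :
    l.map Sigma.fst = l'.map Sigma.fst := by
  obtain ⟨d⟩ := NormalWord.transversal_nonempty φ hφ
  obtain ⟨w, hw, hwl⟩ := hl.exists_normalWord d h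
  obtain ⟨w', hw', hwl'⟩ := hl'.exists_normalWord d h'
  rw [← hwl, ← hwl', NormalWord.prod_injective (hw.trans (e.trans hw'.symm))]

theorem exists_isReducedList (hφ : ∀ i, Function.Injective (φ i)) (z : PushoutI φ) :
    ∃ h l, IsReducedList φ l ∧ z = base φ h * listProd φ l := by
  classical
  obtain ⟨d⟩ := NormalWord.transversal_nonempty φ hφ
  obtain ⟨w, rfl⟩ := (NormalWord.equiv (d := d)).symm.surjective z
  refine ⟨w.head, w.toList, ⟨w.chain_ne, fun g hg hr => w.ne_one g hg ?_⟩, ?_⟩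
  · have := (d.compl g.1).1 (a₁ := (⟨g.2, hr⟩, ⟨1, d.one_mem _⟩))
      (a₂ := (⟨1, one_mem _⟩, ⟨g.2, w.normalized _ _ hg⟩)) (by simp)
    exact congrArg (fun p => (p.1 : G g.1)) this
  · change w.prod = _
    rw [NormalWord.prod, CoprodI.Word.prod, map_list_prod, List.map_map, listProd]
    simp [Function.comp_def]

/-- The center of a nondegenerate amalgamated product lies in the amalgamated subgroup. -/
theorem center_le_range_base [Nontrivial ι] (hφ : ∀ i, Function.Injective (φ i))
    (hne : ∀ i, ∃ a, a ∉ (φ i).range) : Subgroup.center (PushoutI φ) ≤ (base φ).range := by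
  intro z hz
  obtain ⟨h, l, hl, rfl⟩ := exists_isReducedList hφ z
  have hcomm : ∀ i (a : G i), of i (a * φ i h) * listProd φ l =
      base φ h * listProd φ (l ++ [⟨i, a⟩]) := by
    intro i a
    have := Subgroup.mem_center_iff.1 hz (of i a)
    rw [← mul_assoc, ← of_apply_eq_base φ i, ← map_mul, of_apply_eq_base, mul_assoc] at this
    simpa [listProd] using this
  have happend : ∀ i (a : G i), a ∉ (φ i).range → (∀ g ∈ l.getLast?, g.1 ≠ i) →
      IsReducedList φ (l ++ [⟨i, a⟩]) := by
    refine fun i a ha hlast => ⟨?_, ?_⟩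
    · rw [List.isChain_append]
      exact ⟨hl.isChain, by simp, by simpa using hlast⟩
    · intro g hg
      rcases List.mem_append.1 hg with hg | hg
      · exact hl.notMem g hg
      · obtain rfl := List.mem_singleton.1 hg
        exact ha
  rcases l with _ | ⟨⟨i, g⟩, l⟩
  · simp [listProd]
  exfalso
  have hg : g ∉ (φ i).range := hl.notMem _ List.mem_cons_self
  by_cases hlast : ∀ x ∈ ((⟨i, g⟩ : Σ i, G i) :: l).getLast?, x.1 ≠ i
  · have hb : (φ i h * g)⁻¹ ∉ (φ i).range := by
      rw [inv_mem_iff, Subgroup.mul_mem_cancel_left _ (MonoidHom.mem_range.2 ⟨h, rfl⟩)]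
      exact hg
    have e : base φ 1 * listProd φ l =
        base φ h * listProd φ (⟨i, g⟩ :: l ++ [⟨i, (φ i h * g)⁻¹⟩]) := by
      rw [← hcomm]
      rw [listProd, listProd, List.map_cons, List.prod_cons, ← mul_assoc, ← map_mul, map_one]
      simp
    have hmap := IsReducedList.map_fst_eq hφ
      ⟨hl.isChain.tail, fun x hx => hl.notMem x (.tail _ hx)⟩ (happend i _ hb hlast) e
    have hlen : l.length = (⟨i, g⟩ :: l ++ [⟨i, (φ i h * g)⁻¹⟩] : List (Σ i, G i)).length := by
      simpa only [List.length_map, List.tail_cons] using congrArg List.length hmap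
    simp only [List.length_append, List.length_cons] at hlen
    omega
  · push Not at hlast
    obtain ⟨x, hx, hxi⟩ := hlast
    obtain ⟨j, hji⟩ := exists_ne i
    obtain ⟨a, ha⟩ := hne j
    have ha' : a * φ j h ∉ (φ j).range := by
      rwa [Subgroup.mul_mem_cancel_right _ (MonoidHom.mem_range.2 ⟨h, rfl⟩)]
    have hred : IsReducedList φ (⟨j, a * φ j h⟩ :: ⟨i, g⟩ :: l) :=
      ⟨List.isChain_cons_cons.2 ⟨hji, hl.isChain⟩, List.forall_mem_cons.2 ⟨ha', hl.notMem⟩⟩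
    have e : base φ 1 * listProd φ (⟨j, a * φ j h⟩ :: ⟨i, g⟩ :: l) =
        base φ h * listProd φ (⟨i, g⟩ :: l ++ [⟨j, a⟩]) := by
      rw [← hcomm]
      simp [listProd]
    have := IsReducedList.map_fst_eq hφ hred (happend j a ha (by
      intro y hy
      rw [Option.mem_unique hy hx, hxi]
      exact hji.symm)) e
    simp only [List.map_cons, List.cons_append, List.cons.injEq] at this
    exact hji this.1

end Monoid.PushoutI

namespace LabelledGraph

variable {V : Type*}

section AltProd

variable {G : Type*} [Monoid G]

/-- The letter in position `n` (counting from `0`) of the alternating word `u v u v ⋯`. -/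
def altLetter (u v : V) : ℕ → V
  | 0 => u
  | n + 1 => altLetter v u n

theorem altProd_succ' (f : V → G) (u v : V) (n : ℕ) :
    altProd (f u) (f v) (n + 1) = altProd (f u) (f v) n * f (altLetter u v n) := by
  induction n generalizing u v with
  | zero => simp [altProd, altLetter]
  | succ n ih => rw [altProd, ih, altProd, altLetter, mul_assoc]

end AltProd

/-! ### The geometric representation -/

open Classical in
/-- The Gram matrix of the geometric representation. Since `(⊤ : ℕ∞).toNat = 0`, an infinite
label gives the entry `-1`. -/
noncomputable def gram (Γ : LabelledGraph V) (u v : V) : ℝ :=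
  if u = v then 1 else -Real.cos (Real.pi / (Γ.m u v).toNat)

theorem gram_self (Γ : LabelledGraph V) (u : V) : Γ.gram u u = 1 := by simp [gram]

theorem gram_comm (Γ : LabelledGraph V) (u v : V) : Γ.gram u v = Γ.gram v u := by
  unfold gram
  rw [Γ.symm u v]
  by_cases h : u = v
  · simp [h]
  · simp [h, Ne.symm h]

theorem gram_of_ne (Γ : LabelledGraph V) {u v : V} (h : u ≠ v) :
    Γ.gram u v = -Real.cos (Real.pi / (Γ.m u v).toNat) := by simp [gram, h]

theorem gram_eq_neg_one (Γ : LabelledGraph V) {u v : V} (h : u ≠ v) (hm : Γ.m u v = ⊤) :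
    Γ.gram u v = -1 := by simp [gram, h, hm]

/-- The bilinear form of the geometric representation. -/
noncomputable def form (Γ : LabelledGraph V) : (V →₀ ℝ) →ₗ[ℝ] (V →₀ ℝ) →ₗ[ℝ] ℝ :=
  Finsupp.linearCombination ℝ fun u => Finsupp.linearCombination ℝ fun v => Γ.gram u v

/-- The simple root at a vertex. -/
noncomputable def root (v : V) : V →₀ ℝ := Finsupp.single v 1

@[simp]
theorem form_root_root (Γ : LabelledGraph V) (u v : V) :
    Γ.form (root u) (root v) = Γ.gram u v := by
  simp [form, root]

theorem form_comm (Γ : LabelledGraph V) (x y : V →₀ ℝ) : Γ.form x y = Γ.form y x := by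
  have : Γ.form = Γ.form.flip := by
    ext u v
    simpa [root] using (Γ.form_root_root u v).trans
      ((Γ.gram_comm u v).trans (Γ.form_root_root v u).symm)
  exact LinearMap.congr_fun₂ this x y

/-- The simple reflection at a vertex. -/
noncomputable def refl (Γ : LabelledGraph V) (v : V) : (V →₀ ℝ) ≃ₗ[ℝ] (V →₀ ℝ) :=
  Module.reflection (x := root v) (f := (2 : ℝ) • Γ.form (root v)) (by simp [gram_self])

theorem refl_apply (Γ : LabelledGraph V) (v : V) (x : V →₀ ℝ) :
    Γ.refl v x = x - (2 * Γ.form (root v) x) • root v := by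
  simp [refl, Module.reflection_apply]

@[simp]
theorem refl_mul_self (Γ : LabelledGraph V) (v : V) : Γ.refl v * Γ.refl v = 1 := by
  ext1 x
  rw [LinearEquiv.mul_apply, LinearEquiv.coe_one, id]
  simp only [refl_apply, map_sub, map_smul, form_root_root, gram_self]
  module

@[simp]
theorem refl_inv (Γ : LabelledGraph V) (v : V) : (Γ.refl v)⁻¹ = Γ.refl v :=
  Module.reflection_inv _

theorem refl_root_self (Γ : LabelledGraph V) (v : V) : Γ.refl v (root v) = -root v := by
  simp only [refl_apply, form_root_root, gram_self]; module

theorem refl_apply_of_ne (Γ : LabelledGraph V) {u v : V} (h : u ≠ v) (x : V →₀ ℝ) :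
    Γ.refl v x u = x u := by
  simp [refl_apply, root, h.symm]

/-- The group generated by the simple reflections. -/
noncomputable def reflGroup (Γ : LabelledGraph V) : Subgroup ((V →₀ ℝ) ≃ₗ[ℝ] (V →₀ ℝ)) :=
  Subgroup.closure (Set.range Γ.refl)

theorem refl_mem (Γ : LabelledGraph V) (v : V) : Γ.refl v ∈ Γ.reflGroup :=
  Subgroup.subset_closure ⟨v, rfl⟩

theorem altProd_refl_mem (Γ : LabelledGraph V) (u v : V) (n : ℕ) :
    altProd (Γ.refl u) (Γ.refl v) n ∈ Γ.reflGroup := by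
  induction n generalizing u v with
  | zero => exact one_mem _
  | succ n ih => exact mul_mem (Γ.refl_mem u) (ih v u)

theorem form_map_map (Γ : LabelledGraph V) {g : (V →₀ ℝ) ≃ₗ[ℝ] (V →₀ ℝ)}
    (hg : g ∈ Γ.reflGroup) (x y : V →₀ ℝ) : Γ.form (g x) (g y) = Γ.form x y := by
  induction hg using Subgroup.closure_induction generalizing x y with
  | mem g hg =>
    obtain ⟨v, rfl⟩ := hg
    simp only [refl_apply, map_sub, map_smul, LinearMap.sub_apply, LinearMap.smul_apply,
      smul_eq_mul, form_root_root, gram_self, Γ.form_comm x (root v)]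
    ring
  | one => rfl
  | mul g h _ _ ihg ihh => rw [LinearEquiv.mul_apply, LinearEquiv.mul_apply, ihg, ihh]
  | inv g _ ih =>
    rw [← ih, ← LinearEquiv.mul_apply, ← LinearEquiv.mul_apply, mul_inv_cancel]; rfl

theorem mul_refl_of_map_root (Γ : LabelledGraph V) {g : (V →₀ ℝ) ≃ₗ[ℝ] (V →₀ ℝ)}
    (hg : g ∈ Γ.reflGroup) {u v : V} (h : g (root v) = root u) :
    g * Γ.refl v = Γ.refl u * g := by
  ext1 x
  rw [LinearEquiv.mul_apply, LinearEquiv.mul_apply, refl_apply, refl_apply, map_sub, map_smul, h,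
    ← h, Γ.form_map_map hg]

theorem eq_root_of_map_root_eq_smul (Γ : LabelledGraph V) {g : (V →₀ ℝ) ≃ₗ[ℝ] (V →₀ ℝ)}
    (hg : g ∈ Γ.reflGroup) {u v : V} (h₀ : 0 ≤ g (root v))
    (h : ∀ x, x ≠ u → g (root v) x = 0) : g (root v) = root u := by
  have hc : g (root v) = g (root v) u • root u := by
    ext x
    by_cases hx : x = u
    · subst hx; simp [root]
    · rw [h x hx]
      simp [root, Ne.symm hx]
  have hn := Γ.form_map_map hg (root v) (root v)
  rw [hc] at hn
  simp only [map_smul, LinearMap.smul_apply, form_root_root, gram_self, smul_eq_mul] at hn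
  have : g (root v) u = 1 := by
    have h₁ : 0 ≤ g (root v) u := h₀ u
    nlinarith
  rw [hc, this, one_smul]

/-! ### Dihedral subgroups -/

/-- The sequence with `sin θ * dihCoeff (cos θ) n = sin (n * θ)`. -/
def dihCoeff (t : ℝ) : ℕ → ℝ
  | 0 => 0
  | 1 => 1
  | n + 2 => 2 * t * dihCoeff t (n + 1) - dihCoeff t n

theorem dihCoeff_one (n : ℕ) : dihCoeff 1 n = n := by
  induction n using Nat.twoStepInduction with
  | zero => simp [dihCoeff]
  | one => simp [dihCoeff]
  | more n h₀ h₁ => rw [dihCoeff, h₀, h₁]; push_cast; ring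

theorem dihCoeff_cos_mul_sin (θ : ℝ) (n : ℕ) :
    dihCoeff (Real.cos θ) n * Real.sin θ = Real.sin (n * θ) := by
  induction n using Nat.twoStepInduction with
  | zero => simp [dihCoeff]
  | one => simp [dihCoeff]
  | more n h₀ h₁ =>
    have e₀ : (n : ℝ) * θ = ((n + 1 : ℕ) : ℝ) * θ - θ := by push_cast; ring
    have e₂ : ((n + 2 : ℕ) : ℝ) * θ = ((n + 1 : ℕ) : ℝ) * θ + θ := by push_cast; ring
    rw [e₀, Real.sin_sub] at h₀
    rw [dihCoeff, e₂, Real.sin_add, sub_mul, mul_assoc, h₁, h₀]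
    ring

theorem sin_pi_div_pos {k : ℕ} (hk : 2 ≤ k) : 0 < Real.sin (Real.pi / k) := by
  have hk' : (2 : ℝ) ≤ k := by exact_mod_cast hk
  apply Real.sin_pos_of_pos_of_lt_pi (by positivity)
  rw [div_lt_iff₀ (by linarith)]
  nlinarith [Real.pi_pos]

theorem dihCoeff_cos_pi_div {k : ℕ} (hk : 2 ≤ k) (n : ℕ) :
    dihCoeff (Real.cos (Real.pi / k)) n = Real.sin (n * (Real.pi / k)) / Real.sin (Real.pi / k) :=
  (eq_div_iff (sin_pi_div_pos hk).ne').2 (dihCoeff_cos_mul_sin _ _)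

theorem dihCoeff_sub {k : ℕ} (hk : 2 ≤ k) {n : ℕ} (hn : n ≤ k) :
    dihCoeff (Real.cos (Real.pi / k)) (k - n) = dihCoeff (Real.cos (Real.pi / k)) n := by
  have hk' : (k : ℝ) ≠ 0 := by positivity
  rw [dihCoeff_cos_pi_div hk, dihCoeff_cos_pi_div hk, Nat.cast_sub hn, sub_mul,
    mul_div_cancel₀ _ hk', Real.sin_pi_sub]

theorem dihCoeff_nonneg {k : ℕ} (hk : 2 ≤ k) {n : ℕ} (hn : n ≤ k) :
    0 ≤ dihCoeff (Real.cos (Real.pi / k)) n := by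
  rw [dihCoeff_cos_pi_div hk]
  have hk' : (0 : ℝ) < k := by positivity
  have hn' : (n : ℝ) ≤ k := by exact_mod_cast hn
  refine div_nonneg (Real.sin_nonneg_of_nonneg_of_le_pi (by positivity) ?_) (sin_pi_div_pos hk).le
  rw [← mul_div_assoc, div_le_iff₀ hk', mul_comm]
  gcongr

theorem dihCoeff_det_ne_zero {k : ℕ} (hk : 2 ≤ k) {i j : ℕ} (hij : i < j) (hj : j < k) :
    dihCoeff (Real.cos (Real.pi / k)) (i + 1) * dihCoeff (Real.cos (Real.pi / k)) j -
      dihCoeff (Real.cos (Real.pi / k)) i * dihCoeff (Real.cos (Real.pi / k)) (j + 1) ≠ 0 := by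
  set θ := Real.pi / k with hθ
  have hs := sin_pi_div_pos hk
  have hk' : (0 : ℝ) < k := by positivity
  have hpos : 0 < Real.sin ((j - i : ℝ) * θ) := by
    have h₁ : (i : ℝ) < j := by exact_mod_cast hij
    have h₂ : (j : ℝ) < k := by exact_mod_cast hj
    have h₃ : (0 : ℝ) ≤ i := by positivity
    apply Real.sin_pos_of_pos_of_lt_pi (mul_pos (by linarith) (by positivity))
    rw [hθ, ← mul_div_assoc, div_lt_iff₀ hk', mul_comm]
    exact mul_lt_mul_of_pos_left (by linarith) Real.pi_pos
  suffices h : (dihCoeff (Real.cos θ) (i + 1) * dihCoeff (Real.cos θ) j -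
      dihCoeff (Real.cos θ) i * dihCoeff (Real.cos θ) (j + 1)) * Real.sin θ * Real.sin θ =
        Real.sin ((j - i : ℝ) * θ) * Real.sin θ by
    intro h0
    rw [h0, zero_mul, zero_mul] at h
    exact (mul_pos hpos hs).ne h
  calc _ = (dihCoeff (Real.cos θ) (i + 1) * Real.sin θ) * (dihCoeff (Real.cos θ) j * Real.sin θ) -
      (dihCoeff (Real.cos θ) i * Real.sin θ) * (dihCoeff (Real.cos θ) (j + 1) * Real.sin θ) := by
        ring
    _ = _ := by
        rw [dihCoeff_cos_mul_sin, dihCoeff_cos_mul_sin, dihCoeff_cos_mul_sin,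
          dihCoeff_cos_mul_sin]
        push_cast
        rw [sub_mul, add_mul, add_mul, one_mul, Real.sin_add, Real.sin_add, Real.sin_sub]
        ring

/-- The roots crossed along the alternating word `u v u v ⋯`. -/
noncomputable def dihRoot (Γ : LabelledGraph V) (u v : V) : ℕ → V →₀ ℝ
  | 0 => root u
  | n + 1 => Γ.refl u (dihRoot Γ v u n)

theorem dihRoot_eq (Γ : LabelledGraph V) (u v : V) (n : ℕ) :
    Γ.dihRoot u v n =
      dihCoeff (-Γ.gram u v) (n + 1) • root u + dihCoeff (-Γ.gram u v) n • root v := by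
  induction n generalizing u v with
  | zero => simp [dihRoot, dihCoeff]
  | succ n ih =>
    rw [dihRoot, ih, Γ.gram_comm v u, map_add, map_smul, map_smul, refl_root_self, refl_apply,
      form_root_root, dihCoeff]
    module

theorem dihRoot_eq_altProd (Γ : LabelledGraph V) (u v : V) (n : ℕ) :
    Γ.dihRoot u v n = altProd (Γ.refl u) (Γ.refl v) n (root (altLetter u v n)) := by
  induction n generalizing u v with
  | zero => rfl
  | succ n ih => rw [dihRoot, ih, altProd, altLetter, LinearEquiv.mul_apply]

theorem two_le_of_m_eq (Γ : LabelledGraph V) {u v : V} (h : u ≠ v) {k : ℕ}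
    (hk : Γ.m u v = k) : 2 ≤ k := by
  have := Γ.two_le u v h
  rw [hk] at this
  exact_mod_cast this

theorem neg_gram_eq_cos (Γ : LabelledGraph V) {u v : V} (h : u ≠ v) {k : ℕ}
    (hk : Γ.m u v = k) : -Γ.gram u v = Real.cos (Real.pi / k) := by
  simp [Γ.gram_of_ne h, hk]

theorem dihRoot_sub (Γ : LabelledGraph V) {u v : V} (h : u ≠ v) {k : ℕ}
    (hk : Γ.m u v = k) {i : ℕ} (hi : i < k) :
    Γ.dihRoot u v (k - 1 - i) = Γ.dihRoot v u i := by
  have h2 := Γ.two_le_of_m_eq h hk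
  rw [dihRoot_eq, dihRoot_eq, Γ.gram_comm v u, Γ.neg_gram_eq_cos h hk,
    show k - 1 - i + 1 = k - i by omega, dihCoeff_sub h2 hi.le,
    show k - 1 - i = k - (i + 1) by omega, dihCoeff_sub h2 hi, add_comm]

theorem altProd_refl_comm (Γ : LabelledGraph V) {u v : V} (h : u ≠ v) {k : ℕ}
    (hk : Γ.m u v = k) :
    altProd (Γ.refl u) (Γ.refl v) k = altProd (Γ.refl v) (Γ.refl u) k := by
  have h2 := Γ.two_le_of_m_eq h hk
  have e : Γ.dihRoot u v (k - 1) = root v := Γ.dihRoot_sub h hk (i := 0) (by omega)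
  obtain ⟨j, rfl⟩ : ∃ j, k = j + 1 := ⟨k - 1, by omega⟩
  rw [dihRoot_eq_altProd] at e
  rw [altProd_succ', altProd]
  exact Γ.mul_refl_of_map_root (Γ.altProd_refl_mem u v j) e

/-! ### Word length and positivity of roots -/

/-- The word length with respect to the simple reflections. -/
noncomputable def len (Γ : LabelledGraph V) (g : (V →₀ ℝ) ≃ₗ[ℝ] (V →₀ ℝ)) : ℕ :=
  sInf {n | ∃ l : List V, l.length = n ∧ (l.map Γ.refl).prod = g}

theorem len_prod_le (Γ : LabelledGraph V) (l : List V) :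
    Γ.len (l.map Γ.refl).prod ≤ l.length :=
  Nat.sInf_le ⟨l, rfl, rfl⟩

theorem exists_word (Γ : LabelledGraph V) {g : (V →₀ ℝ) ≃ₗ[ℝ] (V →₀ ℝ)}
    (hg : g ∈ Γ.reflGroup) :
    ∃ l : List V, l.length = Γ.len g ∧ (l.map Γ.refl).prod = g := by
  refine Nat.sInf_mem (s := {n | ∃ l : List V, l.length = n ∧ (l.map Γ.refl).prod = g}) ?_
  suffices ∃ l : List V, (l.map Γ.refl).prod = g from this.elim fun l hl => ⟨_, l, rfl, hl⟩
  induction hg using Subgroup.closure_induction with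
  | mem g hg => obtain ⟨v, rfl⟩ := hg; exact ⟨[v], by simp⟩
  | one => exact ⟨[], rfl⟩
  | mul g h _ _ ihg ihh =>
    obtain ⟨l, rfl⟩ := ihg
    obtain ⟨l', rfl⟩ := ihh
    exact ⟨l ++ l', by simp⟩
  | inv g _ ih =>
    obtain ⟨l, rfl⟩ := ih
    exact ⟨l.reverse, by
      rw [List.prod_inv_reverse, List.map_reverse, List.map_map]; simp [Function.comp_def]⟩

theorem len_mul_le (Γ : LabelledGraph V) {g h : (V →₀ ℝ) ≃ₗ[ℝ] (V →₀ ℝ)}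
    (hg : g ∈ Γ.reflGroup) (hh : h ∈ Γ.reflGroup) : Γ.len (g * h) ≤ Γ.len g + Γ.len h := by
  obtain ⟨l, hl, rfl⟩ := Γ.exists_word hg
  obtain ⟨l', hl', rfl⟩ := Γ.exists_word hh
  rw [← hl, ← hl', ← List.prod_append, ← List.map_append, ← List.length_append]
  exact Γ.len_prod_le _

theorem len_refl_le (Γ : LabelledGraph V) (v : V) : Γ.len (Γ.refl v) ≤ 1 := by
  simpa using Γ.len_prod_le [v]

theorem len_altProd_le (Γ : LabelledGraph V) (u v : V) (n : ℕ) :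
    Γ.len (altProd (Γ.refl u) (Γ.refl v) n) ≤ n := by
  induction n generalizing u v with
  | zero => simpa [altProd] using Γ.len_prod_le []
  | succ n ih =>
    have h₁ := Γ.len_mul_le (Γ.refl_mem u) (Γ.altProd_refl_mem v u n)
    have h₂ := Γ.len_refl_le u
    have h₃ := ih v u
    rw [altProd]
    omega

theorem len_altProd_lt (Γ : LabelledGraph V) {u v : V} (h : u ≠ v) {k : ℕ}
    (hk : Γ.m u v = k) {n : ℕ} (hn : k ≤ n) :
    Γ.len (altProd (Γ.refl u) (Γ.refl v) (n + 1)) < n := by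
  induction n, hn using Nat.le_induction generalizing u v with
  | base =>
    have h2 := Γ.two_le_of_m_eq h hk
    rw [altProd, ← Γ.altProd_refl_comm h hk]
    obtain ⟨j, rfl⟩ : ∃ j, k = j + 1 := ⟨k - 1, by omega⟩
    rw [altProd, ← mul_assoc, refl_mul_self, one_mul]
    exact Nat.lt_succ_of_le (Γ.len_altProd_le v u j)
  | succ n _ ih =>
    have h₁ := Γ.len_mul_le (Γ.refl_mem u) (Γ.altProd_refl_mem v u (n + 1))
    have h₂ := Γ.len_refl_le u
    have h₃ := ih h.symm (Γ.symm v u ▸ hk)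
    rw [altProd]
    omega

theorem map_root_nonneg_of_len_le (Γ : LabelledGraph V) {g : (V →₀ ℝ) ≃ₗ[ℝ] (V →₀ ℝ)}
    (hg : g ∈ Γ.reflGroup) (s : V) (h : Γ.len g ≤ Γ.len (g * Γ.refl s)) :
    0 ≤ g (root s) := by
  induction hn : Γ.len g using Nat.strong_induction_on generalizing g s with
  | _ n ih =>
  subst hn
  obtain ⟨l, hl, hlg⟩ := Γ.exists_word hg
  rcases List.eq_nil_or_concat l with rfl | ⟨l', t, rfl⟩
  · rw [← hlg]
    simp [root]
  let P : ℕ → Prop := fun k => ∃ f ∈ Γ.reflGroup, ∃ a b : V, a ≠ b ∧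
    g = f * altProd (Γ.refl a) (Γ.refl b) k ∧ Γ.len f + k = Γ.len g ∧ altLetter a b k = s
  have hP1 : P 1 := by
    set f := (l'.map Γ.refl).prod with hf
    have hgf : g = f * Γ.refl t := by simpa using hlg.symm
    have hfm : f ∈ Γ.reflGroup := Subgroup.list_prod_mem _ (by
      simp only [List.mem_map]; rintro _ ⟨x, _, rfl⟩; exact Γ.refl_mem x)
    have h₁ := Γ.len_prod_le l'
    have h₂ := Γ.len_mul_le hfm (Γ.refl_mem t)
    have h₃ := Γ.len_refl_le t
    rw [← hf] at h₁
    rw [← hgf] at h₂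
    simp only [List.concat_eq_append, List.length_append, List.length_singleton] at hl
    refine ⟨f, hfm, t, s, ?_, by simpa [altProd] using hgf, by omega, rfl⟩
    rintro rfl
    have : g * Γ.refl t = f := by rw [hgf, mul_assoc, refl_mul_self, mul_one]
    rw [this] at h
    omega
  have hP_le : ∀ k, P k → k ≤ Γ.len g := by
    rintro k ⟨f, -, a, b, -, -, hlen, -⟩
    omega
  obtain ⟨k, hk, hmax⟩ : ∃ k, P k ∧ ∀ j, P j → j ≤ k := by
    classical
    exact ⟨Nat.findGreatest P (Γ.len g), Nat.findGreatest_spec (hP_le 1 hP1) hP1,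
      fun j hj => Nat.le_findGreatest (hP_le j hj) hj⟩
  have hk1 : 1 ≤ k := hmax 1 hP1
  obtain ⟨f, hf, a, b, hab, hgf, hlen, hs⟩ := hk
  have hb : 0 ≤ f (root b) := by
    refine ih (Γ.len f) (by omega) hf b ?_ rfl
    by_contra! hlt
    have hfb := mul_mem hf (Γ.refl_mem b)
    have hg' : g = f * Γ.refl b * altProd (Γ.refl b) (Γ.refl a) (k + 1) := by
      rw [altProd, mul_assoc, ← mul_assoc (Γ.refl b), refl_mul_self, one_mul, hgf]
    have h₁ := Γ.len_mul_le hfb (Γ.altProd_refl_mem b a (k + 1))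
    have h₂ := Γ.len_altProd_le b a (k + 1)
    rw [← hg'] at h₁
    have := hmax (k + 1) ⟨f * Γ.refl b, hfb, b, a, hab.symm, hg', by omega, hs⟩
    omega
  have ha : 0 ≤ f (root a) := by
    refine ih (Γ.len f) (by omega) hf a ?_ rfl
    by_contra! hlt
    obtain ⟨j, rfl⟩ : ∃ j, k = j + 1 := ⟨k - 1, by omega⟩
    have hfa := mul_mem hf (Γ.refl_mem a)
    have h₁ := Γ.len_mul_le hfa (Γ.altProd_refl_mem b a j)
    have h₂ := Γ.len_altProd_le b a j
    rw [mul_assoc, ← altProd, ← hgf] at h₁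
    omega
  have hcoeff : ∀ i ≤ k + 1, 0 ≤ dihCoeff (-Γ.gram a b) i := by
    intro i hi
    by_cases htop : Γ.m a b = ⊤
    · rw [Γ.gram_eq_neg_one hab htop, neg_neg, dihCoeff_one]
      positivity
    · obtain ⟨m, hm⟩ := ENat.ne_top_iff_exists.1 htop
      rw [Γ.neg_gram_eq_cos hab hm.symm]
      refine dihCoeff_nonneg (Γ.two_le_of_m_eq hab hm.symm) (hi.trans ?_)
      by_contra! hlt
      have h₁ := Γ.len_altProd_lt hab hm.symm (n := k) (by omega)
      have h₂ := Γ.len_mul_le hf (Γ.altProd_refl_mem a b (k + 1))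
      have h₃ : g * Γ.refl s = f * altProd (Γ.refl a) (Γ.refl b) (k + 1) := by
        rw [altProd_succ', ← mul_assoc, ← hgf, hs]
      rw [h₃] at h
      omega
  have : g (root s) = dihCoeff (-Γ.gram a b) (k + 1) • f (root a) +
      dihCoeff (-Γ.gram a b) k • f (root b) := by
    rw [← map_smul, ← map_smul, ← map_add, ← dihRoot_eq, dihRoot_eq_altProd, hs, hgf,
      LinearEquiv.mul_apply]
  rw [this]
  exact add_nonneg (smul_nonneg (hcoeff _ le_rfl) ha) (smul_nonneg (hcoeff _ k.le_succ) hb)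

theorem map_root_nonneg_or_nonpos (Γ : LabelledGraph V) {g : (V →₀ ℝ) ≃ₗ[ℝ] (V →₀ ℝ)}
    (hg : g ∈ Γ.reflGroup) (s : V) : 0 ≤ g (root s) ∨ g (root s) ≤ 0 := by
  rcases le_total (Γ.len g) (Γ.len (g * Γ.refl s)) with h | h
  · exact Or.inl (Γ.map_root_nonneg_of_len_le hg s h)
  · right
    have := Γ.map_root_nonneg_of_len_le (mul_mem hg (Γ.refl_mem s)) s
      (by rwa [mul_assoc, refl_mul_self, mul_one])
    rwa [LinearEquiv.mul_apply, refl_root_self, map_neg, Left.nonneg_neg_iff] at this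


/-! ### Minimal coset representatives -/

theorem root_injective : Function.Injective (root : V → V →₀ ℝ) :=
  Finsupp.single_left_injective one_ne_zero

theorem root_mem_supported {X : Set V} {v : V} (h : v ∈ X) :
    root v ∈ Finsupp.supported ℝ ℝ X :=
  Finsupp.single_mem_supported ℝ 1 h

theorem mem_of_root_mem_supported {X : Set V} {v : V}
    (h : root v ∈ Finsupp.supported ℝ ℝ X) : v ∈ X := by
  by_contra hv
  have := (Finsupp.mem_supported' ℝ _).1 h v hv
  simp [root] at this

theorem refl_mem_supported_iff (Γ : LabelledGraph V) {X : Set V} {v : V} (h : v ∈ X)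
    {f : V →₀ ℝ} : Γ.refl v f ∈ Finsupp.supported ℝ ℝ X ↔ f ∈ Finsupp.supported ℝ ℝ X := by
  rw [refl_apply, sub_eq_add_neg]
  exact Submodule.add_mem_iff_left _
    (neg_mem (Submodule.smul_mem _ _ (root_mem_supported h)))

/-- The minimal representatives of the cosets of the standard parabolic subgroup on `X`. -/
def MinRep (Γ : LabelledGraph V) (X : Set V) : Type _ :=
  {g : (V →₀ ℝ) ≃ₗ[ℝ] (V →₀ ℝ) // g ∈ Γ.reflGroup ∧ ∀ x ∈ X, 0 ≤ g⁻¹ (root x)}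

theorem map_nonneg_of_mem_supported {X : Set V} {g : (V →₀ ℝ) ≃ₗ[ℝ] (V →₀ ℝ)}
    (hg : ∀ x ∈ X, 0 ≤ g (root x)) {f : V →₀ ℝ} (hf : f ∈ Finsupp.supported ℝ ℝ X)
    (h₀ : 0 ≤ f) : 0 ≤ g f := by
  have : f = ∑ x ∈ f.support, f x • root x := by
    conv_lhs => rw [← f.sum_single]
    simp [Finsupp.sum, root]
  rw [this, map_sum]
  refine Finset.sum_nonneg fun x hx => ?_
  rw [map_smul]
  exact smul_nonneg (h₀ x) (hg x (hf hx))

theorem MinRep.exists_map_root_eq {Γ : LabelledGraph V} {X : Set V} (w : Γ.MinRep X) {s : V}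
    (h : w.1 (root s) ∈ Finsupp.supported ℝ ℝ X) : ∃ x : X, w.1 (root s) = root (x : V) := by
  classical
  obtain ⟨g, hg, hmin⟩ := w
  dsimp only at h ⊢
  set f := g (root s) with hf
  have hgf : g⁻¹ f = root s := by rw [hf, ← LinearEquiv.mul_apply, inv_mul_cancel]; rfl
  rcases Γ.map_root_nonneg_or_nonpos hg s with h₀ | h₀
  · obtain ⟨x, hx⟩ : ∃ x, f x ≠ 0 := by
      by_contra! hall
      have : f = 0 := Finsupp.ext hall
      rw [this, map_zero] at hgf
      have := DFunLike.congr_fun hgf s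
      simp [root] at this
    have hxX : x ∈ X := by
      by_contra hn
      exact hx ((Finsupp.mem_supported' ℝ _).1 h x hn)
    have hxpos : 0 < f x := lt_of_le_of_ne (h₀ x) hx.symm
    have hsplit : f = f x • root x + f.erase x := by
      conv_lhs => rw [← Finsupp.single_add_erase x f]
      simp [root]
    have herase : 0 ≤ g⁻¹ (f.erase x) := by
      refine map_nonneg_of_mem_supported hmin ?_ ?_
      · rw [Finsupp.mem_supported']
        intro v hv
        rw [Finsupp.erase_apply]
        split_ifs
        · rfl
        · exact (Finsupp.mem_supported' ℝ _).1 h v hv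
      · intro v
        rw [Finsupp.erase_apply]
        split_ifs
        · exact le_rfl
        · exact h₀ v
    have hs := Γ.eq_root_of_map_root_eq_smul (inv_mem hg) (u := s) (hmin x hxX) (by
      intro v hv
      have e := DFunLike.congr_fun hgf v
      rw [hsplit, map_add, map_smul, Finsupp.add_apply, Finsupp.smul_apply, smul_eq_mul] at e
      have e' : (root s : V →₀ ℝ) v = 0 := by simp [root, hv.symm]
      have h₁ : 0 ≤ g⁻¹ (root x) v := hmin x hxX v
      have h₂ : 0 ≤ g⁻¹ (f.erase x) v := herase v
      rw [e'] at e
      have h₃ : f x * g⁻¹ (root x) v = 0 := by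
        have := mul_nonneg hxpos.le h₁
        linarith
      exact (mul_eq_zero.1 h₃).resolve_left hx)
    refine ⟨⟨x, hxX⟩, ?_⟩
    rw [hf, ← hs, ← LinearEquiv.mul_apply, mul_inv_cancel]
    rfl
  · have := map_nonneg_of_mem_supported hmin (neg_mem h) (neg_nonneg.2 h₀) s
    rw [map_neg, hgf] at this
    simp [root] at this
    linarith

/-- The minimal representative of the neighbouring coset. -/
noncomputable def MinRep.mulRefl {Γ : LabelledGraph V} {X : Set V} (w : Γ.MinRep X) (s : V)
    (h : ¬ ∃ x : X, w.1 (root s) = root (x : V)) : Γ.MinRep X :=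
  ⟨w.1 * Γ.refl s, mul_mem w.2.1 (Γ.refl_mem s), by
    intro x hx
    have hmem := mul_mem w.2.1 (Γ.refl_mem s)
    refine (Γ.map_root_nonneg_or_nonpos (inv_mem hmem) x).resolve_right fun hneg => h ⟨⟨x, hx⟩, ?_⟩
    have hs : w.1⁻¹ (root x) = root s := by
      refine Γ.eq_root_of_map_root_eq_smul (inv_mem w.2.1) (w.2.2 x hx) fun v hv => ?_
      rw [mul_inv_rev, refl_inv, LinearEquiv.mul_apply] at hneg
      have h₁ := hneg v
      rw [Γ.refl_apply_of_ne hv] at h₁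
      exact le_antisymm h₁ (w.2.2 x hx v)
    rw [← hs, ← LinearEquiv.mul_apply, mul_inv_cancel]
    rfl⟩

noncomputable instance (Γ : LabelledGraph V) (X : Set V) : One (Γ.MinRep X) :=
  ⟨⟨1, one_mem _, fun x _ => by simp [root]⟩⟩

/-! ### The action of an Artin group on the cosets of a parabolic subgroup -/

theorem altProd_σ_comm (Γ : LabelledGraph V) {u v : V} (h : u ≠ v) {k : ℕ}
    (hk : Γ.m u v = k) : altProd (Γ.σ u) (Γ.σ v) k = altProd (Γ.σ v) (Γ.σ u) k := by
  have : PresentedGroup.mk Γ.artinRels (altWord u v k) =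
      PresentedGroup.mk Γ.artinRels (altWord v u k) :=
    PresentedGroup.mk_eq_mk_of_mul_inv_mem ⟨u, v, k, h, hk, rfl⟩
  rwa [altWord, altWord, map_altProd, map_altProd] at this

/-- The universal property of an Artin group. -/
def lift {G : Type*} [Group G] (Γ : LabelledGraph V) (f : V → G)
    (hf : ∀ (u v : V) (k : ℕ), u ≠ v → Γ.m u v = k →
      altProd (f u) (f v) k = altProd (f v) (f u) k) : Γ.ArtinGroup →* G :=
  PresentedGroup.toGroup (f := f) (by
    rintro r ⟨u, v, k, huv, hk, rfl⟩
    rw [map_mul, map_inv, altWord, altWord, map_altProd, map_altProd, mul_inv_eq_one]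
    simpa using hf u v k huv hk)

@[simp]
theorem lift_σ {G : Type*} [Group G] (Γ : LabelledGraph V) (f : V → G)
    (hf : ∀ (u v : V) (k : ℕ), u ≠ v → Γ.m u v = k →
      altProd (f u) (f v) k = altProd (f v) (f u) k) (v : V) : Γ.lift f hf (Γ.σ v) = f v :=
  PresentedGroup.toGroup.of _

theorem closure_range_σ (Γ : LabelledGraph V) : Subgroup.closure (Set.range Γ.σ) = ⊤ :=
  PresentedGroup.closure_range_of _

/-- The set on which the Artin group acts: pairs of an element of the parabolic Artin group and
a minimal coset representative. -/
abbrev CosetState (Γ : LabelledGraph V) (X : Set V) : Type _ :=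
  (Γ.induce X).ArtinGroup × Γ.MinRep X

open Classical in
/-- The action of a standard generator. -/
noncomputable def step (Γ : LabelledGraph V) (X : Set V) (s : V) (q : Γ.CosetState X) :
    Γ.CosetState X :=
  if h : ∃ x : X, q.2.1 (root s) = root (x : V) then (q.1 * (Γ.induce X).σ h.choose, q.2)
  else (q.1, q.2.mulRefl s h)

open Classical in
/-- The action of the inverse of a standard generator. -/
noncomputable def stepInv (Γ : LabelledGraph V) (X : Set V) (s : V) (q : Γ.CosetState X) :
    Γ.CosetState X :=
  if h : ∃ x : X, q.2.1 (root s) = root (x : V) then (q.1 * ((Γ.induce X).σ h.choose)⁻¹, q.2)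
  else (q.1, q.2.mulRefl s h)

section Step

variable (Γ : LabelledGraph V) {X : Set V} {s : V}

theorem step_of_eq {q : Γ.CosetState X} {x : X} (h : q.2.1 (root s) = root (x : V)) :
    Γ.step X s q = (q.1 * (Γ.induce X).σ x, q.2) := by
  have h' : ∃ x : X, q.2.1 (root s) = root (x : V) := ⟨x, h⟩
  have : h'.choose = x := Subtype.ext (root_injective (h'.choose_spec.symm.trans h))
  rw [step, dif_pos h', this]

theorem stepInv_of_eq {q : Γ.CosetState X} {x : X} (h : q.2.1 (root s) = root (x : V)) :
    Γ.stepInv X s q = (q.1 * ((Γ.induce X).σ x)⁻¹, q.2) := by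
  have h' : ∃ x : X, q.2.1 (root s) = root (x : V) := ⟨x, h⟩
  have : h'.choose = x := Subtype.ext (root_injective (h'.choose_spec.symm.trans h))
  rw [stepInv, dif_pos h', this]

theorem step_of_not {q : Γ.CosetState X} (h : ¬ ∃ x : X, q.2.1 (root s) = root (x : V)) :
    Γ.step X s q = (q.1, q.2.mulRefl s h) := dif_neg h

theorem stepInv_of_not {q : Γ.CosetState X} (h : ¬ ∃ x : X, q.2.1 (root s) = root (x : V)) :
    Γ.stepInv X s q = (q.1, q.2.mulRefl s h) := dif_neg h

theorem MinRep.not_mulRefl {w : Γ.MinRep X} (h : ¬ ∃ x : X, w.1 (root s) = root (x : V)) :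
    ¬ ∃ x : X, (w.mulRefl s h).1 (root s) = root (x : V) := by
  rintro ⟨x, hx⟩
  refine h (w.exists_map_root_eq ?_)
  have : w.1 (root s) = -root (x : V) := by
    rw [← hx, MinRep.mulRefl, LinearEquiv.mul_apply, refl_root_self, map_neg, neg_neg]
  rw [this]
  exact neg_mem (root_mem_supported x.2)

theorem MinRep.mulRefl_mulRefl {w : Γ.MinRep X}
    (h : ¬ ∃ x : X, w.1 (root s) = root (x : V)) :
    (w.mulRefl s h).mulRefl s (w.not_mulRefl Γ h) = w :=
  Subtype.ext (by simp [MinRep.mulRefl, mul_assoc])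

/-- The permutation by which a standard generator acts. -/
noncomputable def stepPerm (X : Set V) (s : V) : Equiv.Perm (Γ.CosetState X) where
  toFun := Γ.step X s
  invFun := Γ.stepInv X s
  left_inv q := by
    by_cases h : ∃ x : X, q.2.1 (root s) = root (x : V)
    · obtain ⟨x, hx⟩ := h
      rw [Γ.step_of_eq hx, Γ.stepInv_of_eq (q := (q.1 * (Γ.induce X).σ x, q.2)) hx,
        mul_inv_cancel_right]
    · rw [Γ.step_of_not h, Γ.stepInv_of_not (MinRep.not_mulRefl Γ h), MinRep.mulRefl_mulRefl]
  right_inv q := by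
    by_cases h : ∃ x : X, q.2.1 (root s) = root (x : V)
    · obtain ⟨x, hx⟩ := h
      rw [Γ.stepInv_of_eq hx, Γ.step_of_eq (q := (q.1 * ((Γ.induce X).σ x)⁻¹, q.2)) hx,
        inv_mul_cancel_right]
    · rw [Γ.stepInv_of_not h, Γ.step_of_not (MinRep.not_mulRefl Γ h), MinRep.mulRefl_mulRefl]

/-- The successive action of the letters of the alternating word `a b a b ⋯`. -/
noncomputable def walk (X : Set V) (a b : V) : ℕ → Γ.CosetState X → Γ.CosetState X
  | 0, q => q
  | n + 1, q => walk X b a n (Γ.step X a q)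

theorem walk_of_forall_notMem {a b : V} {n : ℕ} {q : Γ.CosetState X}
    (h : ∀ i < n, q.2.1 (Γ.dihRoot a b i) ∉ Finsupp.supported ℝ ℝ X) :
    (Γ.walk X a b n q).1 = q.1 ∧
      (Γ.walk X a b n q).2.1 = q.2.1 * altProd (Γ.refl a) (Γ.refl b) n := by
  induction n generalizing a b q with
  | zero => simp [walk, altProd]
  | succ n ih =>
    have h₀ : ¬ ∃ x : X, q.2.1 (root a) = root (x : V) := by
      rintro ⟨x, hx⟩
      exact h 0 n.succ_pos (by rw [dihRoot, hx]; exact root_mem_supported x.2)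
    rw [walk, Γ.step_of_not h₀, altProd, ← mul_assoc]
    exact ih fun i hi => h (i + 1) (by omega)

theorem walk_of_exists_unique_mem {a b : V} {n j : ℕ} {q : Γ.CosetState X} (hj : j < n)
    (hmem : q.2.1 (Γ.dihRoot a b j) ∈ Finsupp.supported ℝ ℝ X)
    (h : ∀ i < n, i ≠ j → q.2.1 (Γ.dihRoot a b i) ∉ Finsupp.supported ℝ ℝ X) :
    ∃ x : X, q.2.1 (Γ.dihRoot a b j) = root (x : V) ∧
      (Γ.walk X a b n q).1 = q.1 * (Γ.induce X).σ x ∧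
      (Γ.walk X a b n q).2.1 = Γ.refl x * q.2.1 * altProd (Γ.refl a) (Γ.refl b) n := by
  induction n generalizing a b q j with
  | zero => omega
  | succ n ih =>
    rcases j with _ | j
    · obtain ⟨x, hx⟩ := q.2.exists_map_root_eq hmem
      refine ⟨x, hx, ?_⟩
      have hconj := Γ.mul_refl_of_map_root q.2.2.1 hx
      have := Γ.walk_of_forall_notMem (a := b) (b := a) (n := n) (q := Γ.step X a q) (by
        intro i hi
        rw [Γ.step_of_eq hx]
        have := h (i + 1) (by omega) (by omega)
        rwa [dihRoot, ← LinearEquiv.mul_apply, hconj, LinearEquiv.mul_apply,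
          Γ.refl_mem_supported_iff x.2] at this)
      rw [Γ.step_of_eq hx] at this
      rw [walk, Γ.step_of_eq hx, altProd, ← hconj, ← mul_assoc, mul_assoc q.2.1, refl_mul_self,
        mul_one]
      exact this
    · have h₀ : ¬ ∃ x : X, q.2.1 (root a) = root (x : V) := by
        rintro ⟨x, hx⟩
        exact h 0 n.succ_pos (by omega) (by rw [dihRoot, hx]; exact root_mem_supported x.2)
      rw [walk, Γ.step_of_not h₀]
      obtain ⟨x, hx, h₁, h₂⟩ := ih (q := (q.1, q.2.mulRefl a h₀)) (by omega) hmem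
        fun i hi hij => h (i + 1) (by omega) (by omega)
      refine ⟨x, hx, h₁, h₂.trans ?_⟩
      simp only [MinRep.mulRefl, altProd, mul_assoc]

theorem walk_of_map_root_eq {a b : V} {n : ℕ} {q : Γ.CosetState X} {x y : X}
    (hx : q.2.1 (root a) = root (x : V)) (hy : q.2.1 (root b) = root (y : V)) :
    Γ.walk X a b n q = (q.1 * altProd ((Γ.induce X).σ x) ((Γ.induce X).σ y) n, q.2) := by
  induction n generalizing a b q x y with
  | zero => simp [walk, altProd]
  | succ n ih =>
    rw [walk, Γ.step_of_eq hx, altProd, ← mul_assoc]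
    exact ih (q := (q.1 * (Γ.induce X).σ x, q.2)) hy hx

theorem m_eq_of_gram_eq {u v u' v' : V} (h : u ≠ v) (h' : u' ≠ v')
    (hgram : Γ.gram u v = Γ.gram u' v') {k : ℕ} (hk : Γ.m u v = k) : Γ.m u' v' = k := by
  have hmem : ∀ n : ℕ, Real.pi / n ∈ Set.Icc 0 Real.pi := by
    intro n
    refine ⟨by positivity, ?_⟩
    rcases n.eq_zero_or_pos with rfl | hn
    · simp [Real.pi_pos.le]
    · exact div_le_self Real.pi_pos.le (by exact_mod_cast hn)
  rw [Γ.gram_of_ne h, Γ.gram_of_ne h', neg_inj, hk, ENat.toNat_natCast] at hgram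
  have := Real.injOn_cos (hmem _) (hmem _) hgram
  rw [div_eq_mul_inv, div_eq_mul_inv, mul_right_inj' Real.pi_ne_zero, inv_inj,
    Nat.cast_inj] at this
  have h2 := Γ.two_le_of_m_eq h hk
  have htop : Γ.m u' v' ≠ ⊤ := by
    intro htop
    rw [htop, ENat.toNat_top] at this
    omega
  rw [this, ENat.natCast_toNat htop]

theorem walk_comm {a b : V} (hab : a ≠ b) {k : ℕ} (hk : Γ.m a b = k) (q : Γ.CosetState X) :
    Γ.walk X a b k q = Γ.walk X b a k q := by
  have hk' : Γ.m b a = k := Γ.symm a b ▸ hk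
  have hrev : ∀ i < k, Γ.dihRoot b a i = Γ.dihRoot a b (k - 1 - i) := fun i hi =>
    (Γ.dihRoot_sub hab hk hi).symm
  by_cases h₂ : ∃ i j, i < j ∧ j < k ∧ q.2.1 (Γ.dihRoot a b i) ∈ Finsupp.supported ℝ ℝ X ∧
      q.2.1 (Γ.dihRoot a b j) ∈ Finsupp.supported ℝ ℝ X
  · obtain ⟨i, j, hij, hj, hi_mem, hj_mem⟩ := h₂
    have hdet := dihCoeff_det_ne_zero (Γ.two_le_of_m_eq hab hk) hij hj
    rw [dihRoot_eq, Γ.neg_gram_eq_cos hab hk, map_add, map_smul, map_smul] at hi_mem hj_mem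
    set p := dihCoeff (Real.cos (Real.pi / k))
    have ha : q.2.1 (root a) ∈ Finsupp.supported ℝ ℝ X := by
      rw [← Submodule.smul_mem_iff _ hdet]
      convert sub_mem (Submodule.smul_mem _ (p j) hi_mem) (Submodule.smul_mem _ (p i) hj_mem)
        using 1
      module
    have hb : q.2.1 (root b) ∈ Finsupp.supported ℝ ℝ X := by
      rw [← Submodule.smul_mem_iff _ hdet]
      convert sub_mem (Submodule.smul_mem _ (p (i + 1)) hj_mem)
        (Submodule.smul_mem _ (p (j + 1)) hi_mem) using 1
      module
    obtain ⟨x, hx⟩ := q.2.exists_map_root_eq ha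
    obtain ⟨y, hy⟩ := q.2.exists_map_root_eq hb
    have hxy : x ≠ y := by
      rintro rfl
      exact hab (root_injective (q.2.1.injective (hx.trans hy.symm)))
    have hgram : Γ.gram a b = Γ.gram x y := by
      rw [← form_root_root, ← form_root_root, ← hx, ← hy, Γ.form_map_map q.2.2.1]
    have hm : (Γ.induce X).m x y = k :=
      Γ.m_eq_of_gram_eq hab (fun e => hxy (Subtype.ext e)) hgram hk
    rw [Γ.walk_of_map_root_eq hx hy, Γ.walk_of_map_root_eq hy hx,
      (Γ.induce X).altProd_σ_comm hxy hm]
  by_cases h₁ : ∃ j < k, q.2.1 (Γ.dihRoot a b j) ∈ Finsupp.supported ℝ ℝ X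
  · obtain ⟨j, hj, hmem⟩ := h₁
    have hne : ∀ i < k, i ≠ j → q.2.1 (Γ.dihRoot a b i) ∉ Finsupp.supported ℝ ℝ X := by
      intro i hi hij hi_mem
      rcases lt_or_gt_of_ne hij with h | h
      · exact h₂ ⟨i, j, h, hj, hi_mem, hmem⟩
      · exact h₂ ⟨j, i, h, hi, hmem, hi_mem⟩
    have hj' : k - 1 - (k - 1 - j) = j := by omega
    obtain ⟨x, hx, hx₁, hx₂⟩ := Γ.walk_of_exists_unique_mem hj hmem hne
    obtain ⟨y, hy, hy₁, hy₂⟩ := Γ.walk_of_exists_unique_mem (a := b) (b := a) (q := q)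
      (j := k - 1 - j) (n := k) (by omega) (by rwa [hrev _ (by omega), hj'])
      (fun i hi hij => by rw [hrev i hi]; exact hne _ (by omega) (by omega))
    rw [hrev _ (by omega), hj'] at hy
    obtain rfl : x = y := Subtype.ext (root_injective (hx.symm.trans hy))
    refine Prod.ext (hx₁.trans hy₁.symm) (Subtype.ext ?_)
    rw [hx₂, hy₂, Γ.altProd_refl_comm hab hk]
  · push Not at h₁
    obtain ⟨hx₁, hx₂⟩ := Γ.walk_of_forall_notMem h₁
    obtain ⟨hy₁, hy₂⟩ := Γ.walk_of_forall_notMem (a := b) (b := a) (q := q) (n := k)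
      (fun i hi => by rw [hrev i hi]; exact h₁ _ (by omega))
    refine Prod.ext (hx₁.trans hy₁.symm) (Subtype.ext ?_)
    rw [hx₂, hy₂, Γ.altProd_refl_comm hab hk]

theorem unop_altProd_stepPerm (X : Set V) (a b : V) (n : ℕ) (q : Γ.CosetState X) :
    (altProd (MulOpposite.op (Γ.stepPerm X a)) (MulOpposite.op (Γ.stepPerm X b)) n).unop q =
      Γ.walk X a b n q := by
  induction n generalizing a b q with
  | zero => rfl
  | succ n ih =>
    rw [altProd, MulOpposite.unop_mul, Equiv.Perm.mul_apply, ih]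
    rfl

/-- The right action of an Artin group on `CosetState`. -/
noncomputable def cosetAction (X : Set V) :
    Γ.ArtinGroup →* (Equiv.Perm (Γ.CosetState X))ᵐᵒᵖ :=
  Γ.lift (fun s => MulOpposite.op (Γ.stepPerm X s)) fun a b k hab hk =>
    MulOpposite.unop_injective <| Equiv.ext fun q => by
      rw [unop_altProd_stepPerm, unop_altProd_stepPerm, Γ.walk_comm hab hk]

theorem cosetAction_σ_apply (X : Set V) (s : V) (q : Γ.CosetState X) :
    (Γ.cosetAction X (Γ.σ s)).unop q = Γ.step X s q := by
  rw [cosetAction, lift_σ]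
  rfl

theorem cosetAction_inv_σ_apply (X : Set V) (s : V) (q : Γ.CosetState X) :
    (Γ.cosetAction X (Γ.σ s)⁻¹).unop q = Γ.stepInv X s q := by
  rw [map_inv, cosetAction, lift_σ]
  rfl

theorem cosetAction_mul_apply (X : Set V) (g h : Γ.ArtinGroup) (q : Γ.CosetState X) :
    (Γ.cosetAction X (g * h)).unop q =
      (Γ.cosetAction X h).unop ((Γ.cosetAction X g).unop q) := by
  rw [map_mul]
  rfl

end Step

/-! ### Special subgroups -/

theorem inclHom_σ (Γ : LabelledGraph V) (X : Set V) (x : X) :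
    Γ.inclHom X ((Γ.induce X).σ x) = Γ.σ x :=
  mapHom_σ _ _ _ _ _ x

theorem cosetAction_inclHom (Γ : LabelledGraph V) (X : Set V) (c d : (Γ.induce X).ArtinGroup) :
    (Γ.cosetAction X (Γ.inclHom X c)).unop (d, 1) = (d * c, 1) := by
  have hc : c ∈ Subgroup.closure (Set.range (Γ.induce X).σ) := by
    rw [closure_range_σ]; trivial
  induction hc using Subgroup.closure_induction generalizing d with
  | mem c hc =>
    obtain ⟨x, rfl⟩ := hc
    rw [inclHom_σ, cosetAction_σ_apply, Γ.step_of_eq (x := x) rfl]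
  | one => simp
  | mul c c' _ _ ih ih' => rw [map_mul, cosetAction_mul_apply, ih, ih', mul_assoc]
  | inv c _ ih =>
    have := ih (d * c⁻¹)
    rw [inv_mul_cancel_right] at this
    rw [← this, ← cosetAction_mul_apply, ← map_mul, mul_inv_cancel, map_one, map_one]
    rfl

/-- Special subgroups of Artin groups are Artin groups. -/
theorem inclHom_injective (Γ : LabelledGraph V) (X : Set V) :
    Function.Injective (Γ.inclHom X) := by
  intro c d h
  have := Γ.cosetAction_inclHom X c 1
  rw [h, cosetAction_inclHom] at this
  simpa using (congrArg Prod.fst this).symm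

theorem map_inclHom_specialSubgroup (Γ : LabelledGraph V) (X : Set V) (K : Set X) :
    ((Γ.induce X).specialSubgroup K).map (Γ.inclHom X) =
      Γ.specialSubgroup (Subtype.val '' K) := by
  rw [specialSubgroup, MonoidHom.map_closure, specialSubgroup, Set.image_image, Set.image_image]
  simp only [inclHom_σ]

theorem range_inclHom (Γ : LabelledGraph V) (X : Set V) :
    (Γ.inclHom X).range = Γ.specialSubgroup X := by
  rw [MonoidHom.range_eq_map, ← closure_range_σ, ← Set.image_univ]
  refine (Γ.map_inclHom_specialSubgroup X Set.univ).trans ?_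
  rw [Set.image_univ, Subtype.range_coe]

/-- The special subgroups of an Artin group are closed under intersection. -/
theorem specialSubgroup_inf_le (Γ : LabelledGraph V) (X Y : Set V) :
    Γ.specialSubgroup X ⊓ Γ.specialSubgroup Y ≤ Γ.specialSubgroup (X ∩ Y) := by
  rintro g ⟨hX, hY⟩
  let P : Γ.CosetState X → Prop := fun q =>
    q.1 ∈ (Γ.induce X).specialSubgroup (Subtype.val ⁻¹' Y) ∧
      ∀ y ∈ Y, q.2.1 (root y) ∈ Finsupp.supported ℝ ℝ Y
  have hσ : ∀ (q : Γ.CosetState X) (x : X) (s : V), s ∈ Y → P q →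
      q.2.1 (root s) = root (x : V) →
        (Γ.induce X).σ x ∈ (Γ.induce X).specialSubgroup (Subtype.val ⁻¹' Y) := by
    intro q x s hs hq hx
    have hxY : (x : V) ∈ Y := mem_of_root_mem_supported (by rw [← hx]; exact hq.2 s hs)
    exact Subgroup.subset_closure ⟨x, hxY, rfl⟩
  have hmul : ∀ (q : Γ.CosetState X) (s : V) (_ : s ∈ Y) (_ : P q)
      (h : ¬ ∃ x : X, q.2.1 (root s) = root (x : V)), P (q.1, q.2.mulRefl s h) := by
    refine fun q s hs hq h => ⟨hq.1, fun y hy => ?_⟩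
    rw [MinRep.mulRefl, LinearEquiv.mul_apply, refl_apply, map_sub, map_smul]
    exact sub_mem (hq.2 y hy) (Submodule.smul_mem _ _ (hq.2 s hs))
  have hstep : ∀ s ∈ Y, ∀ q, P q → P (Γ.step X s q) := by
    intro s hs q hq
    by_cases h : ∃ x : X, q.2.1 (root s) = root (x : V)
    · obtain ⟨x, hx⟩ := h
      rw [Γ.step_of_eq hx]
      exact ⟨mul_mem hq.1 (hσ q x s hs hq hx), hq.2⟩
    · rw [Γ.step_of_not h]
      exact hmul q s hs hq h
  have hstepInv : ∀ s ∈ Y, ∀ q, P q → P (Γ.stepInv X s q) := by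
    intro s hs q hq
    by_cases h : ∃ x : X, q.2.1 (root s) = root (x : V)
    · obtain ⟨x, hx⟩ := h
      rw [Γ.stepInv_of_eq hx]
      exact ⟨mul_mem hq.1 (inv_mem (hσ q x s hs hq hx)), hq.2⟩
    · rw [Γ.stepInv_of_not h]
      exact hmul q s hs hq h
  have hP : (∀ q, P q → P ((Γ.cosetAction X g).unop q)) ∧
      ∀ q, P q → P ((Γ.cosetAction X g⁻¹).unop q) := by
    clear hX
    induction hY using Subgroup.closure_induction with
    | mem g hg =>
      obtain ⟨s, hs, rfl⟩ := hg
      simp only [cosetAction_σ_apply, cosetAction_inv_σ_apply]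
      exact ⟨hstep s hs, hstepInv s hs⟩
    | one => simp
    | mul g h _ _ ihg ihh =>
      simp only [mul_inv_rev, cosetAction_mul_apply]
      exact ⟨fun q hq => ihh.1 _ (ihg.1 _ hq), fun q hq => ihg.2 _ (ihh.2 _ hq)⟩
    | inv g _ ih => rw [inv_inv]; exact ⟨ih.2, ih.1⟩
  rw [← range_inclHom] at hX
  obtain ⟨c, rfl⟩ := hX
  have h₁ := hP.1 (1, 1) ⟨one_mem _, fun y hy => root_mem_supported hy⟩
  rw [cosetAction_inclHom, one_mul] at h₁
  have h₂ := Subgroup.mem_map_of_mem (Γ.inclHom X) h₁.1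
  rwa [map_inclHom_specialSubgroup, Subtype.image_preimage_coe] at h₂

/-- The geometric representation of an Artin group. -/
noncomputable def reflHom (Γ : LabelledGraph V) :
    Γ.ArtinGroup →* ((V →₀ ℝ) ≃ₗ[ℝ] (V →₀ ℝ)) :=
  Γ.lift Γ.refl fun _ _ _ h hk => Γ.altProd_refl_comm h hk

theorem σ_mem_specialSubgroup_iff (Γ : LabelledGraph V) {v : V} {K : Set V} :
    Γ.σ v ∈ Γ.specialSubgroup K ↔ v ∈ K := by
  refine ⟨fun h => ?_, fun h => Subgroup.subset_closure ⟨v, h, rfl⟩⟩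
  by_contra hv
  have key : ∀ g ∈ Γ.specialSubgroup K, ∀ x, Γ.reflHom g x v = x v := by
    intro g hg
    induction hg using Subgroup.closure_induction with
    | mem g hg =>
      obtain ⟨u, hu, rfl⟩ := hg
      intro x
      rw [reflHom, lift_σ, Γ.refl_apply_of_ne (by rintro rfl; exact hv hu)]
    | one => simp
    | mul g h _ _ ihg ihh => intro x; rw [map_mul, LinearEquiv.mul_apply, ihg, ihh]
    | inv g _ ih =>
      intro x
      rw [← ih, ← LinearEquiv.mul_apply, ← map_mul, mul_inv_cancel, map_one]
      rfl
  have := key _ h (root v)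
  rw [reflHom, lift_σ, refl_root_self] at this
  norm_num [root] at this


/-! ### The center of an Artin group -/

open Monoid in
/-- The center of an Artin group avoids any vertex with an infinite label. -/
theorem center_le_specialSubgroup_compl_pair (Γ : LabelledGraph V) {v w : V} (hvw : v ≠ w)
    (hm : Γ.m v w = ⊤) :
    Subgroup.center Γ.ArtinGroup ≤ Γ.specialSubgroup {v, w}ᶜ := by
  classical
  let a : Bool → V := fun b => cond b v w
  have ha : ∀ b, a b ≠ a !b := by rintro (_ | _); exacts [hvw.symm, hvw]
  have hpair : ∀ b u, u ∈ ({v, w} : Set V)ᶜ ↔ u ≠ a b ∧ u ≠ a !b := by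
    rintro (_ | _) u <;> simp [a, and_comm]
  let K : Bool → Subgroup Γ.ArtinGroup := fun b => Γ.specialSubgroup {a b}ᶜ
  let C : Subgroup Γ.ArtinGroup := Γ.specialSubgroup {v, w}ᶜ
  have hCK : ∀ b, C ≤ K b := fun b => Subgroup.closure_mono <| Set.image_mono fun u hu =>
    ((hpair b u).1 hu).1
  let φ : ∀ b, C →* K b := fun b => Subgroup.inclusion (hCK b)
  have hσ : ∀ {b u}, u ≠ a b → Γ.σ u ∈ K b := fun h => Γ.σ_mem_specialSubgroup_iff.2 h
  let f₀ : V → PushoutI φ := fun u =>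
    if h : u ≠ a true then PushoutI.of true ⟨Γ.σ u, hσ h⟩ else
      PushoutI.of false ⟨Γ.σ u, hσ fun e => ha true ((not_not.1 h).symm.trans e)⟩
  have hf₀ : ∀ b u (h : u ≠ a b), f₀ u = PushoutI.of b ⟨Γ.σ u, hσ h⟩ := by
    intro b u h
    by_cases ht : u ≠ a true
    · rw [show f₀ u = PushoutI.of true ⟨Γ.σ u, hσ ht⟩ from dif_pos ht]
      cases b
      · have hu : Γ.σ u ∈ C := Γ.σ_mem_specialSubgroup_iff.2 ((hpair true u).2 ⟨ht, h⟩)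
        exact (PushoutI.of_apply_eq_base φ true ⟨_, hu⟩).trans
          (PushoutI.of_apply_eq_base φ false ⟨_, hu⟩).symm
      · rfl
    · cases b
      · exact dif_neg ht
      · exact absurd h ht
  let f : Γ.ArtinGroup →* PushoutI φ := Γ.lift f₀ fun x y k hxy hk => by
    obtain ⟨b, hx, hy⟩ : ∃ b, x ≠ a b ∧ y ≠ a b := by
      by_contra! hall
      have h₁ := hall true
      have h₂ := hall false
      by_cases hx : x = v
      · subst hx
        obtain rfl : y = w := h₂ hvw
        exact ENat.natCast_ne_top k (hk.symm.trans hm)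
      · obtain rfl : y = v := h₁ hx
        obtain rfl : x = w := by
          by_contra hx'
          exact hvw (h₂ hx')
        exact ENat.natCast_ne_top k (hk.symm.trans ((Γ.symm _ _).trans hm))
    rw [hf₀ b x hx, hf₀ b y hy, ← map_altProd, ← map_altProd]
    congr 1
    apply (K b).subtype_injective
    rw [map_altProd, map_altProd]
    exact Γ.altProd_σ_comm hxy hk
  have hf : ∀ b (k : K b), f k = PushoutI.of b k := by
    rintro b ⟨k, hk⟩
    induction hk using Subgroup.closure_induction with
    | mem k hk =>
      obtain ⟨u, hu, rfl⟩ := hk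
      exact (Γ.lift_σ f₀ _ u).trans (hf₀ b u hu)
    | one => exact (map_one f).trans (map_one _).symm
    | mul k k' hk hk' ih ih' =>
      rw [map_mul, ih, ih', ← map_mul]; rfl
    | inv k hk ih =>
      rw [map_inv, ih, ← map_inv]; rfl
  have hfC : ∀ c : C, f c = PushoutI.base φ c := fun c =>
    (hf true (φ true c)).trans (PushoutI.of_apply_eq_base φ true c)
  let r : PushoutI φ →* Γ.ArtinGroup :=
    PushoutI.lift (fun b => (K b).subtype) C.subtype fun _ => rfl
  have hrf : ∀ z, r (f z) = z := by
    have : r.comp f = MonoidHom.id _ := PresentedGroup.ext fun u => by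
      obtain ⟨b, hb⟩ : ∃ b, u ≠ a b := by
        by_contra! hall
        exact ha true ((hall true).symm.trans (hall false))
      change r (f (Γ.σ u)) = Γ.σ u
      rw [show f (Γ.σ u) = _ from hf b ⟨Γ.σ u, hσ hb⟩]
      exact PushoutI.lift_of _ _ _ _
    exact DFunLike.congr_fun this
  have hsurj : Function.Surjective f := by
    intro p
    induction p using PushoutI.induction_on with
    | of b k => exact ⟨k, hf b k⟩
    | base c => exact ⟨c, hfC c⟩
    | mul x y hx hy =>
      obtain ⟨x, rfl⟩ := hx
      obtain ⟨y, rfl⟩ := hy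
      exact ⟨x * y, map_mul f x y⟩
  intro z hz
  have hfz : f z ∈ Subgroup.center (PushoutI φ) := by
    rw [Subgroup.mem_center_iff] at hz ⊢
    intro p
    obtain ⟨p, rfl⟩ := hsurj p
    rw [← map_mul, hz, map_mul]
  obtain ⟨c, hc⟩ := PushoutI.center_le_range_base
    (fun b => Subgroup.inclusion_injective (hCK b)) (fun b => by
      refine ⟨⟨Γ.σ (a !b), hσ (ha b).symm⟩, ?_⟩
      rintro ⟨⟨c, hcC⟩, hc⟩
      have hc' : c = Γ.σ (a !b) := congrArg Subtype.val hc
      subst hc'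
      exact ((hpair b _).1 (Γ.σ_mem_specialSubgroup_iff.1 hcC)).2 rfl) hfz
  rw [← hrf z, ← hc, ← hfC, hrf]
  exact c.2

theorem specialSubgroup_mono (Γ : LabelledGraph V) {X Y : Set V} (h : X ⊆ Y) :
    Γ.specialSubgroup X ≤ Γ.specialSubgroup Y :=
  Subgroup.closure_mono (Set.image_mono h)

theorem specialSubgroup_univ (Γ : LabelledGraph V) : Γ.specialSubgroup Set.univ = ⊤ := by
  rw [specialSubgroup, Set.image_univ, closure_range_σ]

theorem center_le_specialSubgroup_conePoints [Finite V] (Γ : LabelledGraph V) :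
    Subgroup.center Γ.ArtinGroup ≤ Γ.specialSubgroup {t | Γ.IsConePoint t} := by
  suffices h : ∀ S : Set V, (∀ s ∈ S, ¬ Γ.IsConePoint s) →
      Subgroup.center Γ.ArtinGroup ≤ Γ.specialSubgroup Sᶜ by
    simpa [Set.compl_def] using h {t | ¬ Γ.IsConePoint t} fun _ ht => ht
  intro S
  induction S, S.toFinite using Set.Finite.induction_on with
  | empty => simp [specialSubgroup_univ]
  | insert _ _ ih =>
    rename_i v S _ _
    intro hS
    obtain ⟨w, hwv, hw⟩ : ∃ w, w ≠ v ∧ Γ.m v w = ⊤ := by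
      simpa [IsConePoint] using hS v (Set.mem_insert _ _)
    rw [Set.insert_eq, Set.compl_union]
    refine le_trans (le_inf ?_ (ih fun s hs => hS s (Set.mem_insert_of_mem _ hs)))
      (Γ.specialSubgroup_inf_le _ _)
    exact (Γ.center_le_specialSubgroup_compl_pair hwv.symm hw).trans
      (Γ.specialSubgroup_mono (Set.compl_subset_compl.2 (by simp)))

end LabelledGraph

/-- Let `T` be the set of cone points of `Γ`. If the Artin group of
the induced subgraph `Γ_T` has trivial center, then `A_Γ` has trivial center. -/
theorem center_eq_bot_of_conePoints_center_eq_bot {V : Type*} [Finite V]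
    (Γ : LabelledGraph V)
    (h : Subgroup.center (Γ.induce {t | Γ.IsConePoint t}).ArtinGroup = ⊥) :
    Subgroup.center Γ.ArtinGroup = ⊥ := by
  refine (Subgroup.eq_bot_iff_forall _).2 fun z hz => ?_
  have hzT := Γ.center_le_specialSubgroup_conePoints hz
  rw [← LabelledGraph.range_inclHom] at hzT
  obtain ⟨c, rfl⟩ := hzT
  have hc : c ∈ Subgroup.center (Γ.induce {t | Γ.IsConePoint t}).ArtinGroup := by
    rw [Subgroup.mem_center_iff] at hz ⊢
    intro g
    apply Γ.inclHom_injective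
    rw [map_mul, map_mul, hz]
  rw [h, Subgroup.mem_bot] at hc
  rw [hc, map_one]
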